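/- arXiv:2001.10521 — 2 statements merged into one kernel-verified Lean document; each statement's English description precedes it below -/
import Mathlib

section
/- Let p be a prime, n ≥ 1 an integer, and G a group of order p^n. Then |C(G)| ≤ 1 + (p^n - 1)/(p - 1), which is the number of cyclic subgroups of the elementary abelian group C_p^n, and equality holds if and only if exp(G) = p. -/
/-- The number of cyclic subgroups of a group `G` (including the trivial subgroup). -/
noncomputable def numCyclicSubgroups (G : Type*) [Group G] : ℕ :=
  Nat.card {H : Subgroup G // IsCyclic H}

open Subgroup in
theorem card_filter_zpowers_eq {G : Type*} [Group G] [Fintype G] (H : Subgroup G)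
    [DecidablePred fun g : G => zpowers g = H] (hH : IsCyclic H) :
    (Finset.univ.filter fun g : G => zpowers g = H).card = Nat.totient (Nat.card H) := by
  classical
  have : Fintype H := Fintype.ofFinite H
  rw [← IsCyclic.card_orderOf_eq_totient (α := H) (d := Nat.card H)
    (by rw [Nat.card_eq_fintype_card]), ← Finset.card_map (Function.Embedding.subtype _)]
  congr 1
  ext g
  simp only [Finset.mem_filter, Finset.mem_univ, true_and, Finset.mem_map,
    Function.Embedding.subtype_apply]
  constructor
  · rintro rfl
    exact ⟨⟨g, mem_zpowers g⟩, by rw [orderOf_mk, Nat.card_zpowers], rfl⟩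
  · rintro ⟨x, hx, rfl⟩
    refine eq_of_le_of_card_ge (zpowers_le.2 x.2) ?_
    rw [Nat.card_zpowers, orderOf_coe, hx]

/-- Each element contributes the reciprocal of the number of generators of the cyclic subgroup
it generates. -/
theorem numCyclicSubgroups_eq_sum (G : Type*) [Group G] [Fintype G] :
    (numCyclicSubgroups G : ℚ) = ∑ g : G, ((Nat.totient (orderOf g) : ℚ))⁻¹ := by
  classical
  have : Fintype {H : Subgroup G // IsCyclic H} := Fintype.ofFinite _
  let f : G → {H : Subgroup G // IsCyclic H} := fun g => ⟨Subgroup.zpowers g, inferInstance⟩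
  rw [← Finset.sum_fiberwise Finset.univ f, numCyclicSubgroups, Nat.card_eq_fintype_card,
    ← Finset.card_univ, Finset.cast_card]
  refine Finset.sum_congr rfl fun H _ => ?_
  have hpos : Nat.totient (Nat.card H.1) ≠ 0 := (Nat.totient_pos.2 Nat.card_pos).ne'
  have key := card_filter_zpowers_eq H.1 H.2
  calc (1 : ℚ) = ∑ g with Subgroup.zpowers g = H.1, ((Nat.totient (Nat.card H.1) : ℚ))⁻¹ := by
        rw [Finset.sum_const, key, nsmul_eq_mul, mul_inv_cancel₀ (by exact_mod_cast hpos)]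
    _ = _ := by
        refine Finset.sum_congr (by simp [f, Subtype.ext_iff]) fun g hg => ?_
        rw [← (Finset.mem_filter.1 hg).2, Nat.card_zpowers]

theorem Nat.inv_totient_prime_pow_succ_le {p : ℕ} (hp : p.Prime) (k : ℕ) :
    ((Nat.totient (p ^ (k + 1)) : ℚ))⁻¹ ≤ ((p : ℚ) - 1)⁻¹ ∧
      (((Nat.totient (p ^ (k + 1)) : ℚ))⁻¹ = ((p : ℚ) - 1)⁻¹ ↔ p ^ (k + 1) = p) := by
  have hp1 : (1 : ℚ) < p := by exact_mod_cast hp.one_lt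
  have hpos : (0 : ℚ) < (p : ℚ) - 1 := by linarith
  rw [Nat.totient_prime_pow_succ hp, Nat.cast_mul, Nat.cast_pow, Nat.cast_pred hp.pos]
  constructor
  · exact inv_anti₀ hpos (le_mul_of_one_le_left hpos.le (one_le_pow₀ hp1.le))
  · rw [inv_inj, mul_eq_right₀ hpos.ne', pow_succ, mul_eq_right₀ hp.ne_zero]
    norm_cast

theorem numCyclicSubgroups_le_and_eq_iff {p n : ℕ} (hp : p.Prime) (G : Type*) [Group G]
    (hG : Nat.card G = p ^ n) :
    (numCyclicSubgroups G : ℚ) ≤ 1 + ((p : ℚ) ^ n - 1) / ((p : ℚ) - 1) ∧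
      ((numCyclicSubgroups G : ℚ) = 1 + ((p : ℚ) ^ n - 1) / ((p : ℚ) - 1) ↔
        ∀ g : G, g ≠ 1 → orderOf g = p) := by
  classical
  have : Finite G := Nat.finite_of_card_ne_zero (hG ▸ pow_ne_zero n hp.ne_zero)
  have : Fintype G := Fintype.ofFinite G
  have hterm : ∀ g ∈ Finset.univ.erase (1 : G),
      ((Nat.totient (orderOf g) : ℚ))⁻¹ ≤ ((p : ℚ) - 1)⁻¹ ∧
        (((Nat.totient (orderOf g) : ℚ))⁻¹ = ((p : ℚ) - 1)⁻¹ ↔ orderOf g = p) := by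
    intro g hg
    obtain ⟨k, -, hk⟩ := (Nat.dvd_prime_pow hp).1 (hG ▸ orderOf_dvd_natCard g)
    cases k with
    | zero => exact absurd (orderOf_eq_one_iff.1 (by simpa using hk)) (Finset.ne_of_mem_erase hg)
    | succ k => rw [hk]; exact Nat.inv_totient_prime_pow_succ_le hp k
  have hbound : ((p : ℚ) ^ n - 1) / ((p : ℚ) - 1) =
      ∑ _g ∈ Finset.univ.erase (1 : G), ((p : ℚ) - 1)⁻¹ := by
    rw [Finset.sum_const, Finset.card_erase_of_mem (Finset.mem_univ _), Finset.card_univ,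
      ← Nat.card_eq_fintype_card, hG, nsmul_eq_mul, Nat.cast_pred (pow_pos hp.pos n),
      Nat.cast_pow, div_eq_mul_inv]
  rw [numCyclicSubgroups_eq_sum, ← Finset.add_sum_erase _ _ (Finset.mem_univ (1 : G)), hbound]
  simp only [orderOf_one, Nat.totient_one, Nat.cast_one, inv_one, add_le_add_iff_left,
    add_right_inj]
  refine ⟨Finset.sum_le_sum fun g hg => (hterm g hg).1, ?_⟩
  rw [Finset.sum_eq_sum_iff_of_le fun g hg => (hterm g hg).1]
  exact ⟨fun h g hg => (hterm g (by simpa using hg)).2.1 (h g (by simpa using hg)),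
    fun h g hg => (hterm g hg).2.2 (h g (Finset.ne_of_mem_erase hg))⟩

theorem numCyclic_max {p n : ℕ} (hp : p.Prime) (hn : 1 ≤ n) (G : Type*) [Group G]
    (hG : Nat.card G = p ^ n) :
    (numCyclicSubgroups G : ℚ) ≤ 1 + ((p : ℚ) ^ n - 1) / ((p : ℚ) - 1) ∧
      (numCyclicSubgroups (Multiplicative (Fin n → ZMod p)) : ℚ) =
        1 + ((p : ℚ) ^ n - 1) / ((p : ℚ) - 1) ∧
      ((numCyclicSubgroups G : ℚ) = 1 + ((p : ℚ) ^ n - 1) / ((p : ℚ) - 1) ↔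
        Monoid.exponent G = p) := by
  have : Fact p.Prime := ⟨hp⟩
  have : Finite G := Nat.finite_of_card_ne_zero (hG ▸ pow_ne_zero n hp.ne_zero)
  have : Nontrivial G := Finite.one_lt_card_iff_nontrivial.1
    (hG ▸ Nat.one_lt_pow (by lia) hp.one_lt)
  obtain ⟨hle, heq⟩ := numCyclicSubgroups_le_and_eq_iff hp G hG
  refine ⟨hle, (numCyclicSubgroups_le_and_eq_iff hp _ (by simp)).2.2 ?_,
    heq.trans (Monoid.exponent_eq_prime_iff hp).symm⟩
  intro g hg
  refine orderOf_eq_prime (Multiplicative.toAdd.injective ?_) hg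
  ext i
  simp
end

section
/- Let G be a group of order 3^n (n ≥ 3) with exp(G) ≠ 3 and Ω_1(G) = G. Then the number of cyclic subgroups of G satisfies |C(G)| ≤ (23·3^{n-3} + 1)/2. -/
open scoped commutatorElement

section
variable {G : Type*} [Group G]

theorem anticommute_of_second_difference {φ : G → ZMod 3}
    (h : ∀ g x w : G, φ (g * (x * (x * w))) - 2 * φ (g * (x * w)) + φ (g * w) = 0)
    (g x y w : G) :
    φ (g * (x * (y * w))) + φ (g * (y * (x * w))) - 2 * φ (g * (x * w)) - 2 * φ (g * (y * w))
      + 2 * φ (g * w) = 0 := by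
  have key : ∀ g x y w : G, φ (g * (x * (y * (x * (y * w))))) - φ (g * (x * (y * (y * w))))
      - φ (g * (x * (x * (y * w)))) + 2 * φ (g * (x * (y * w))) - φ (g * (y * (x * (y * w))))
      + φ (g * (y * (y * w))) - φ (g * (y * w)) = 0 := by
    intro g x y w
    have e1 := h (g * x) (x * y) w
    have e2 := h g (x * y) w
    have e3 := h (g * x) y w
    have e4 := h g y w
    have e5 := h g x (y * (x * (y * w)))
    have e6 := h g x (y * w)
    simp only [mul_assoc] at e1 e2 e3 e4 e5 e6
    linear_combination e1 - e2 - e3 + e4 - e5 + e6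
  have key' := key g y x (x⁻¹ * w)
  simp only [mul_inv_cancel_left] at key'
  have e1 := h g (x * y) w
  have e2 := h g x (y * w)
  have e3 := h (g * x) y w
  have e4 := key g x y w
  simp only [mul_assoc] at e1 e2 e3 e4
  linear_combination e1 - e2 - e3 - e4 - key'

theorem third_difference_eq_zero {φ : G → ZMod 3}
    (h : ∀ g x w : G, φ (g * (x * (x * w))) - 2 * φ (g * (x * w)) + φ (g * w) = 0)
    (x y z : G) :
    φ (x * (y * z)) - φ (x * y) - φ (x * z) - φ (y * z) + φ x + φ y + φ z - φ 1 = 0 := by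
  have A := anticommute_of_second_difference h
  have e1 := A 1 (x * y) z 1
  have e2 := A 1 x z 1
  have e3 := A 1 y z 1
  have e4 := A 1 z x y
  have e5 := A x z y 1
  simp only [mul_assoc, one_mul, mul_one] at e1 e2 e3 e4 e5
  have h3 : (3 : ZMod 3) = 0 := rfl
  linear_combination 2 * (e1 - e2 - e3 - (e4 - e2) + (e5 - e3)) - h3 *
    (φ (x * (y * z)) - φ (x * y) - φ (x * z) - φ (y * z) + φ x + φ y + φ z - φ 1)

/-- A quadratic function with values in `ZMod 3` has a translation
along which it changes by a nonzero constant. -/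
theorem exists_translation_of_second_difference {φ : G → ZMod 3} (h1 : φ 1 = 0)
    (h : ∀ g x w : G, φ (g * (x * (x * w))) - 2 * φ (g * (x * w)) + φ (g * w) = 0)
    (hφ : ∃ x, φ x ≠ 0) : ∃ u, φ u ≠ 0 ∧ ∀ x, φ (x * u) = φ x + φ u := by
  have hT := third_difference_eq_zero h
  by_cases hc : ∀ x y, φ (x * y) = φ x + φ y
  · obtain ⟨u, hu⟩ := hφ
    exact ⟨u, hu, fun x => hc x u⟩
  push Not at hc
  obtain ⟨y, z, hyz⟩ := hc
  have hsymm := anticommute_of_second_difference h 1 y z 1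
  simp only [one_mul, mul_one, h1] at hsymm
  let c (x : G) : G →* Multiplicative (ZMod 3) :=
    { toFun := fun y => Multiplicative.ofAdd (φ (x * y) - φ x - φ y)
      map_one' := by simp [h1]
      map_mul' := fun a b => by
        rw [← ofAdd_add]
        congr 1
        linear_combination hT x a b + h1 }
  have hu : ∀ x, φ (x * (y⁻¹ * z⁻¹ * y * z)) = φ x + φ (y⁻¹ * z⁻¹ * y * z) := by
    intro x
    have : c x (y⁻¹ * z⁻¹ * y * z) = 1 := by
      simp only [map_mul, map_inv]
      rw [mul_right_comm _ (c x z)⁻¹, inv_mul_cancel, one_mul, inv_mul_cancel]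
    have : φ (x * (y⁻¹ * z⁻¹ * y * z)) - φ x - φ (y⁻¹ * z⁻¹ * y * z) = 0 := this
    linear_combination this
  refine ⟨y⁻¹ * z⁻¹ * y * z, ?_, hu⟩
  intro h0
  have hzy := hu (z * y)
  rw [h0, show z * y * (y⁻¹ * z⁻¹ * y * z) = y * z by group] at hzy
  have h3 : (3 : ZMod 3) = 0 := rfl
  apply hyz
  linear_combination 2 * hsymm + hzy * 2 - h3 * (φ (y * z) - φ y - φ z)

theorem three_mul_card_le_of_disjoint_translates [Finite G] {S : Set G} (u : G)
    (h1 : ∀ x ∈ S, x * u ∉ S) (h2 : ∀ x ∈ S, x * u * u ∉ S) :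
    3 * Nat.card S ≤ Nat.card G := by
  classical
  have := Fintype.ofFinite G
  let f : G → ℕ := fun x => if x ∈ S then 1 else 0
  have hf : ∑ x, f x = Nat.card S := by
    simp [f, Nat.card_eq_fintype_card, Fintype.card_subtype]
  have e1 : ∑ x, f (x * u) = ∑ x, f x := Equiv.sum_comp (Equiv.mulRight u) f
  have e2 : ∑ x, f (x * u * u) = ∑ x, f x := by
    rw [← e1]; exact Equiv.sum_comp (Equiv.mulRight u) fun x => f (x * u)
  calc 3 * Nat.card S = ∑ x, (f x + f (x * u) + f (x * u * u)) := by
        rw [Finset.sum_add_distrib, Finset.sum_add_distrib, e1, e2, hf]; ring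
    _ ≤ ∑ x : G, 1 := by
        refine Finset.sum_le_sum fun x _ => ?_
        have a := h1 x
        have b := h2 x
        have d := h1 (x * u)
        simp only [f]
        split_ifs <;> simp_all
    _ = Nat.card G := by simp [Nat.card_eq_fintype_card]

/-- If `x`, `x * k` and `x * k⁻¹` all have trivial cube, then `k` commutes with its
conjugate by `x`. -/
theorem commute_conj_of_cube_eq_one {x k : G} (h0 : x ^ 3 = 1) (h1 : (x * k) ^ 3 = 1)
    (h2 : (x * k⁻¹) ^ 3 = 1) : Commute k (x * k * x⁻¹) := by
  have hx : x * x = x⁻¹ := by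
    rw [eq_inv_iff_mul_eq_one, ← h0, pow_three']
  have e1 : k * x * k = x⁻¹ * k⁻¹ * x⁻¹ := by
    rw [← mul_right_inj x, ← mul_left_inj (x * k)]
    calc x * (k * x * k) * (x * k) = (x * k) ^ 3 := by rw [pow_three]; group
      _ = x * (x⁻¹ * k⁻¹ * x⁻¹) * (x * k) := by rw [h1]; group
  have e2 : k⁻¹ * x * k⁻¹ = x⁻¹ * k * x⁻¹ := by
    rw [← mul_right_inj x, ← mul_left_inj (x * k⁻¹)]
    calc x * (k⁻¹ * x * k⁻¹) * (x * k⁻¹) = (x * k⁻¹) ^ 3 := by rw [pow_three]; group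
      _ = x * (x⁻¹ * k * x⁻¹) * (x * k⁻¹) := by rw [h2]; group
  have e3 : k * x⁻¹ * k = x * k⁻¹ * x := by
    simpa [mul_assoc] using congrArg (·⁻¹) e2
  calc k * (x * k * x⁻¹) = (k * x * k) * x⁻¹ := by group
    _ = x⁻¹ * k⁻¹ * (x⁻¹ * x⁻¹) := by rw [e1]; group
    _ = (x * x) * k⁻¹ * x := by
      rw [hx, show x⁻¹ * x⁻¹ = x by rw [← mul_inv_rev, hx, inv_inv]]
    _ = x * (x * k⁻¹ * x) := by group
    _ = x * k * x⁻¹ * k := by rw [← e3]; group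

theorem cube_card_le_of_commute_conj_card_le [Finite G] (k : G)
    (hk : 3 * Nat.card {x : G | Commute k (x * k * x⁻¹)} ≤ Nat.card G) :
    9 * Nat.card {x : G | x ^ 3 = 1} ≤ 7 * Nat.card G := by
  classical
  have := Fintype.ofFinite G
  let s : G → ℕ := fun x => if Commute k (x * k * x⁻¹) then 1 else 0
  let f : G → ℕ := fun x => if x ^ 3 = 1 then 1 else 0
  let r : G → ℕ := fun x => f x * (1 - s x)
  have hs : ∑ x, s x = Nat.card {x : G | Commute k (x * k * x⁻¹)} := by
    simp [s, Nat.card_eq_fintype_card, Fintype.card_subtype]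
  have hf : ∑ x, f x = Nat.card {x : G | x ^ 3 = 1} := by
    simp [f, Nat.card_eq_fintype_card, Fintype.card_subtype]
  have hG : ∑ x : G, 1 = Nat.card G := by simp [Nat.card_eq_fintype_card]
  have e1 : ∑ x, r (x * k) = ∑ x, r x := Equiv.sum_comp (Equiv.mulRight k) r
  have e2 : ∑ x, r (x * k⁻¹) = ∑ x, r x := Equiv.sum_comp (Equiv.mulRight k⁻¹) r
  have hr : 3 * ∑ x, r x + 2 * ∑ x, s x ≤ 2 * Nat.card G := by
    calc _ = ∑ x, (r x + r (x * k) + r (x * k⁻¹) + 2 * s x) := by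
          simp only [Finset.sum_add_distrib, e1, e2, ← Finset.mul_sum]; ring
      _ ≤ ∑ x : G, 2 * 1 := by
          refine Finset.sum_le_sum fun x _ => ?_
          have a : s (x * k) = s x := by
            simp [s, mul_assoc]
          have b : s (x * k⁻¹) = s x := by
            simp [s, mul_assoc]
          have d := @commute_conj_of_cube_eq_one G _ x k
          simp only [r, a, b]
          by_cases hc : Commute k (x * k * x⁻¹)
          · simp [s, hc]
          · simp only [s, hc, f, if_false]
            split_ifs <;> simp_all
      _ = _ := by rw [← Finset.mul_sum, hG]
  have hfr : ∑ x, f x ≤ ∑ x, s x + ∑ x, r x := by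
    rw [← Finset.sum_add_distrib]
    refine Finset.sum_le_sum fun x _ => ?_
    simp only [r, f, s]
    split_ifs <;> simp
  omega

theorem exists_additive_character {Z : Subgroup G} (hZ : Nat.card Z = 3) :
    ∃ ζ : G → ZMod 3, (∀ a ∈ Z, ∀ b ∈ Z, ζ (a * b) = ζ a + ζ b) ∧
      ∀ a ∈ Z, ζ a = 0 ↔ a = 1 := by
  classical
  have : Fact (Nat.Prime 3) := ⟨Nat.prime_three⟩
  let ψ : Z ≃* Multiplicative (ZMod 3) := mulEquivOfPrimeCardEq (p := 3) hZ (by simp)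
  refine ⟨fun a => if h : a ∈ Z then (ψ ⟨a, h⟩).toAdd else 0, ?_, ?_⟩
  · intro a ha b hb
    simp only [ha, hb, mul_mem ha hb, dif_pos]
    rw [← toAdd_mul, ← map_mul]
    rfl
  · intro a ha
    simp only [ha, dif_pos]
    rw [toAdd_eq_zero, map_eq_one_iff ψ ψ.injective]
    simp

theorem commutator_mul_of_mem_center {k a b : G} (hb : ⁅k, b⁆ ∈ Subgroup.center G) :
    ⁅k, a * b⁆ = ⁅k, a⁆ * ⁅k, b⁆ := by
  calc ⁅k, a * b⁆ = k * a * k⁻¹ * (⁅k, b⁆ * a⁻¹) := by simp only [commutatorElement_def]; group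
    _ = k * a * k⁻¹ * (a⁻¹ * ⁅k, b⁆) := by
      rw [Subgroup.mem_center_iff.1 hb a⁻¹]
    _ = _ := by simp only [commutatorElement_def]; group

theorem cube_card_le_of_commute_conj [Finite G]
    (hcube : ∀ x : G, x ^ 3 ∈ Subgroup.center G)
    (hcube3 : ∀ x : G, (x ^ 3) ^ 3 = 1)
    (hengel : ∀ k x : G, Commute k (x * k * x⁻¹))
    (hne : ∃ x : G, x ^ 3 ≠ 1) :
    3 * Nat.card {x : G | x ^ 3 = 1} ≤ Nat.card G := by
  have hmul : ∀ x k : G, (x * k) ^ 3 = x ^ 3 * k ^ 3 := by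
    intro x k
    obtain ⟨c, hc⟩ : ∃ c, c = x * k * x⁻¹ * k⁻¹ := ⟨_, rfl⟩
    have hxk : x * k * x⁻¹ = c * k := by rw [hc]; group
    have hck : Commute c k := by
      rw [hc]
      exact ((hengel k x).symm.mul_left (Commute.refl k).inv_left)
    have hcx : Commute c x := by
      have := (hengel x k).symm.inv_left
      rw [hc, show x * k * x⁻¹ * k⁻¹ = x * (k * x * k⁻¹)⁻¹ by group]
      exact (Commute.refl x).mul_left this
    have hc3 : c ^ 3 = 1 := by
      have : (x * k * x⁻¹) ^ 3 = k ^ 3 := by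
        rw [conj_pow, Subgroup.mem_center_iff.1 (hcube k) x, mul_inv_cancel_right]
      rwa [hxk, hck.mul_pow, mul_eq_right] at this
    have hxk' : x * k = c * (k * x) := by rw [← mul_assoc, ← hxk]; group
    have hkx' : k * x = c⁻¹ * (x * k) := by rw [hxk']; group
    have hd3 : ∀ w, c⁻¹ * (c⁻¹ * (c⁻¹ * w)) = w := fun w => by
      rw [show c⁻¹ * (c⁻¹ * (c⁻¹ * w)) = (c ^ 3)⁻¹ * w by rw [pow_three]; group, hc3]
      simp
    have hswap : ∀ w, k * (x * w) = c⁻¹ * (x * (k * w)) := fun w => by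
      rw [← mul_assoc, hkx']
      group
    simp only [pow_three, mul_assoc, hswap, hcx.symm.inv_right.left_comm,
      hck.symm.inv_right.left_comm, hd3]
  obtain ⟨u, hu⟩ := hne
  refine three_mul_card_le_of_disjoint_translates u ?_ ?_
  · intro x hx hxu
    simp only [Set.mem_ofPred_eq] at hx hxu
    rw [hmul, hx, one_mul] at hxu
    exact hu hxu
  · intro x hx hxu
    simp only [Set.mem_ofPred_eq] at hx hxu
    rw [hmul, hmul, hx, one_mul] at hxu
    have h9 := hcube3 u
    rw [pow_three (u ^ 3), hxu, mul_one] at h9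
    exact hu h9

theorem commute_conj_card_le [Finite G] {Z : Subgroup G} (hZ : Nat.card Z = 3)
    (hZc : Z ≤ Subgroup.center G) (hcube : ∀ x : G, x ^ 3 ∈ Z)
    {k : G} (hcomm : ∀ x : G, ⁅k, x * k * x⁻¹⁆ ∈ Z) (hk : ∃ x : G, ¬ Commute k (x * k * x⁻¹)) :
    3 * Nat.card {x : G | Commute k (x * k * x⁻¹)} ≤ Nat.card G := by
  obtain ⟨ζ, hζmul, hζ⟩ := exists_additive_character hZ
  have hS : ∀ x, ζ ⁅k, x * k * x⁻¹⁆ = 0 ↔ Commute k (x * k * x⁻¹) := fun x => by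
    rw [hζ _ (hcomm x), commutatorElement_eq_one_iff_commute]
  have hdiff : ∀ g x w : G, ζ ⁅k, (g * (x * (x * w))) * k * (g * (x * (x * w)))⁻¹⁆
      - 2 * ζ ⁅k, (g * (x * w)) * k * (g * (x * w))⁻¹⁆ + ζ ⁅k, (g * w) * k * (g * w)⁻¹⁆ = 0 := by
    intro g x w
    have h0 : ζ (⁅k, (g * (x * (x * w))) * k * (g * (x * (x * w)))⁻¹⁆ *
        (⁅k, (g * (x * w)) * k * (g * (x * w))⁻¹⁆ * ⁅k, (g * w) * k * (g * w)⁻¹⁆)) = 0 := by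
      rw [hζ _ (mul_mem (hcomm _) (mul_mem (hcomm _) (hcomm _))),
        ← commutator_mul_of_mem_center (hZc (hcomm _)),
        ← commutator_mul_of_mem_center, commutatorElement_eq_one_iff_commute]
      · have h1 : Commute k (g * (x ^ 3 * (x⁻¹ * (w * k * w⁻¹)) ^ 3) * g⁻¹) := by
          have := Subgroup.mem_center_iff.1 (hZc (mul_mem (hcube x) (hcube (x⁻¹ * (w * k * w⁻¹)))))
          rw [this g, mul_inv_cancel_right]
          exact this k
        convert h1 using 1
        simp only [pow_three]
        group
      · rw [commutator_mul_of_mem_center (hZc (hcomm _))]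
        exact hZc (mul_mem (hcomm _) (hcomm _))
    rw [hζmul _ (hcomm _) _ (mul_mem (hcomm _) (hcomm _)), hζmul _ (hcomm _) _ (hcomm _)] at h0
    have h3 : (3 : ZMod 3) = 0 := rfl
    linear_combination h0 - h3 * ζ ⁅k, (g * (x * w)) * k * (g * (x * w))⁻¹⁆
  obtain ⟨u, hu0, hu⟩ := exists_translation_of_second_difference
    (φ := fun x => ζ ⁅k, x * k * x⁻¹⁆) ((hS 1).2 (by simp)) hdiff
    (by simpa only [ne_eq, hS] using hk)
  refine three_mul_card_le_of_disjoint_translates u ?_ ?_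
  · intro x hx hxu
    simp only [Set.mem_ofPred_eq, ← hS] at hx hxu
    rw [hu, hx, zero_add] at hxu
    exact hu0 hxu
  · intro x hx hxu
    simp only [Set.mem_ofPred_eq, ← hS] at hx hxu
    rw [hu, hu, hx, zero_add] at hxu
    have h3 : (3 : ZMod 3) = 0 := rfl
    apply hu0
    linear_combination 2 * hxu - h3 * ζ ⁅k, u * k * u⁻¹⁆

theorem cube_card_le_mul_quotient [Finite G] (Z : Subgroup G) [Z.Normal] :
    Nat.card {x : G | x ^ 3 = 1} ≤ Nat.card {q : G ⧸ Z | q ^ 3 = 1} * Nat.card Z := by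
  rw [← Nat.card_prod]
  have hmem : ∀ x : G, (x : G ⧸ Z).out⁻¹ * x ∈ Z := fun x =>
    QuotientGroup.eq.1 (Quotient.out_eq' (x : G ⧸ Z))
  refine Nat.card_le_card_of_injective
    (fun x : {x : G | x ^ 3 = 1} => ((⟨(x : G), by
      have h : (x : G) ^ 3 = 1 := x.2
      simp [← QuotientGroup.mk_pow, h]⟩ : {q : G ⧸ Z | q ^ 3 = 1}),
      (⟨_, hmem x⟩ : Z))) ?_
  intro x y hxy
  simp only [Prod.mk.injEq, Subtype.mk.injEq] at hxy
  obtain ⟨h1, h2⟩ := hxy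
  rw [h1] at h2
  exact Subtype.ext (mul_left_cancel h2)

end

/-- **Laffey's theorem**: in a finite 3-group whose cubes are not all trivial, at most `7/9` of
the elements have trivial cube. -/
theorem cube_card_le_of_card_eq {n : ℕ} (G : Type*) [Group G] (hG : Nat.card G = 3 ^ n)
    (hne : ∃ x : G, x ^ 3 ≠ 1) : 9 * Nat.card {x : G | x ^ 3 = 1} ≤ 7 * Nat.card G := by
  induction n generalizing G with
  | zero =>
    obtain ⟨x, hx⟩ := hne
    have : Subsingleton G := (Nat.card_eq_one_iff_unique.1 hG).1
    exact absurd (Subsingleton.elim _ _) hx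
  | succ n ih =>
    have : Fact (Nat.Prime 3) := ⟨Nat.prime_three⟩
    have hfin : Finite G := Nat.finite_of_card_ne_zero (by rw [hG]; positivity)
    have hp : IsPGroup 3 G := IsPGroup.of_card hG
    have : Nontrivial G := by
      obtain ⟨x, hx⟩ := hne
      exact ⟨_, _, hx⟩
    have := hp.center_nontrivial
    have hpc : IsPGroup 3 (Subgroup.center G) := hp.to_subgroup _
    obtain ⟨z, hz⟩ : ∃ z : Subgroup.center G, orderOf z = 3 := by
      refine exists_prime_orderOf_dvd_card' 3 ?_
      obtain ⟨m, hm0, hm⟩ := hpc.nontrivial_iff_card.1 this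
      exact hm ▸ dvd_pow_self 3 hm0.ne'
    obtain ⟨Z, hZdef⟩ : ∃ Z, Z = Subgroup.zpowers (z : G) := ⟨_, rfl⟩
    have hZ : Nat.card Z = 3 := by
      rw [hZdef, Nat.card_zpowers, Subgroup.orderOf_coe, hz]
    have hZc : Z ≤ Subgroup.center G := by
      rw [hZdef, Subgroup.zpowers_le]
      exact z.2
    have hZn : Z.Normal := ⟨fun a ha g => by
      rw [Subgroup.mem_center_iff.1 (hZc ha) g, mul_inv_cancel_right]
      exact ha⟩
    have hcard := Subgroup.card_eq_card_quotient_mul_card_subgroup Z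
    by_cases hq : ∃ q : G ⧸ Z, q ^ 3 ≠ 1
    · have hQ : Nat.card (G ⧸ Z) = 3 ^ n := by
        rw [hG, hZ, pow_succ] at hcard
        omega
      have h1 := ih (G ⧸ Z) hQ hq
      have h2 := cube_card_le_mul_quotient Z
      rw [hZ] at h2 hcard
      omega
    push Not at hq
    have hcube : ∀ x : G, x ^ 3 ∈ Z := fun x => by
      rw [← QuotientGroup.eq_one_iff]
      exact hq x
    have hcube3 : ∀ x : G, (x ^ 3) ^ 3 = 1 := fun x => by
      have := pow_card_eq_one' (x := (⟨x ^ 3, hcube x⟩ : Z))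
      rw [hZ] at this
      exact congrArg Subtype.val this
    have hcomm : ∀ k x : G, ⁅k, x * k * x⁻¹⁆ ∈ Z := fun k x => by
      rw [← QuotientGroup.eq_one_iff]
      exact commutatorElement_eq_one_iff_commute.2
        (commute_conj_of_cube_eq_one (x := (x : G ⧸ Z)) (k := k) (hq _) (hq _) (hq _))
    by_cases hengel : ∀ k x : G, Commute k (x * k * x⁻¹)
    · have := cube_card_le_of_commute_conj (fun x => hZc (hcube x)) hcube3 hengel hne
      omega
    push Not at hengel
    obtain ⟨k, hk⟩ := hengel
    exact cube_card_le_of_commute_conj_card_le k (commute_conj_card_le hZ hZc hcube (hcomm k) hk)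

section
variable {G : Type*} [Group G]

theorem card_le_card_zpowers_eq {x : G} {s : Finset ℕ} (hs : ∀ i ∈ s, i < orderOf x)
    (hs' : ∀ i ∈ s, i.Coprime (orderOf x)) [Fintype G] [DecidableEq (Subgroup G)] :
    s.card ≤ (Finset.univ.filter fun y : G =>
      Subgroup.zpowers y = Subgroup.zpowers x).card := by
  refine Finset.card_le_card_of_injOn (fun i => x ^ i) ?_ ?_
  · intro i hi
    simp only [Finset.coe_filter, Finset.mem_univ, true_and, Set.mem_ofPred_eq]
    refine le_antisymm ?_ ?_
    · exact Subgroup.zpowers_le.2 (Subgroup.pow_mem _ (Subgroup.mem_zpowers x) i)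
    · exact Subgroup.zpowers_le.2 (mem_zpowers_pow_iff.2 (hs' i hi))
  · exact pow_injOn_Iio_orderOf.mono hs

theorem six_mul_numCyclicSubgroups_le [Finite G] (hp : IsPGroup 3 G) :
    6 * numCyclicSubgroups G ≤ 3 + 2 * Nat.card {x : G | x ^ 3 = 1} + Nat.card G := by
  classical
  have := Fintype.ofFinite G
  have : Fact (Nat.Prime 3) := ⟨Nat.prime_three⟩
  let w : G → ℕ := fun x => (if x = 1 then 3 else 0) + 2 * (if x ^ 3 = 1 then 1 else 0) + 1
  have hw : ∑ x, w x = 3 + 2 * Nat.card {x : G | x ^ 3 = 1} + Nat.card G := by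
    simp only [w, Finset.sum_add_distrib, ← Finset.mul_sum]
    simp [Nat.card_eq_fintype_card, Fintype.card_subtype]
  let S : Finset (Subgroup G) := Finset.univ.image fun x : G => Subgroup.zpowers x
  have hS : numCyclicSubgroups G = S.card := by
    rw [numCyclicSubgroups, Nat.card_eq_fintype_card, Fintype.card_subtype]
    congr 1
    ext H
    simp [S, Subgroup.isCyclic_iff_exists_zpowers_eq_top]
  rw [← hw, hS, mul_comm, ← smul_eq_mul,
    ← Finset.sum_fiberwise_of_maps_to (t := S) (g := fun x : G => Subgroup.zpowers x)
      (fun x _ => Finset.mem_image_of_mem _ (Finset.mem_univ x))]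
  refine Finset.card_nsmul_le_sum _ _ _ fun H hH => ?_
  obtain ⟨x, -, rfl⟩ := Finset.mem_image.1 hH
  have hbound : ∀ m : ℕ, ∀ s : Finset ℕ, (∀ i ∈ s, i < orderOf x) →
      (∀ i ∈ s, i.Coprime (orderOf x)) →
      (∀ y : G, Subgroup.zpowers y = Subgroup.zpowers x → m ≤ w y) → 6 ≤ s.card * m →
      6 ≤ ∑ y ∈ Finset.univ.filter (fun y : G =>
        Subgroup.zpowers y = Subgroup.zpowers x), w y := by
    intro m s h1 h2 h3 h4
    refine h4.trans ((Nat.mul_le_mul_right m (card_le_card_zpowers_eq h1 h2)).trans ?_)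
    rw [← smul_eq_mul]
    exact Finset.card_nsmul_le_sum _ _ _ fun y hy => h3 y (Finset.mem_filter.1 hy).2
  have hord : ∀ y : G, Subgroup.zpowers y = Subgroup.zpowers x → orderOf y = orderOf x :=
    fun y hy => by rw [← Nat.card_zpowers, hy, Nat.card_zpowers]
  obtain ⟨m, hm⟩ := IsPGroup.iff_orderOf.1 hp x
  match m, hm with
  | 0, hm =>
    refine hbound 6 {0} (by simp [hm]) (by simp [hm]) (fun y hy => ?_) (by simp)
    have : y = 1 := by rw [← orderOf_eq_one_iff, hord y hy, hm, pow_zero]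
    simp [w, this]
  | 1, hm =>
    refine hbound 3 {1, 2} (by simp [hm]) (by simp [hm]; norm_num) (fun y hy => ?_) (by simp)
    have : y ^ 3 = 1 := by
      rw [← orderOf_dvd_iff_pow_eq_one, hord y hy, hm, pow_one]
    simp [w, this]
  | m + 2, hm =>
    have h9 : 9 ≤ orderOf x := by
      rw [hm, pow_add]
      have := Nat.one_le_pow m 3 (by norm_num)
      omega
    refine hbound 1 {1, 2, 4, 5, 7, 8} (fun i hi => ?_) (fun i hi => ?_) (fun y _ => ?_) (by simp)
    · simp only [Finset.mem_insert, Finset.mem_singleton] at hi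
      omega
    · rw [hm]
      refine Nat.Coprime.pow_right _ ?_
      simp only [Finset.mem_insert, Finset.mem_singleton] at hi
      rcases hi with rfl | rfl | rfl | rfl | rfl | rfl <;> norm_num
    · simp [w]

end

theorem numCyclic_bound_three {n : ℕ} (hn : 3 ≤ n) (G : Type*) [Group G]
    (hG : Nat.card G = 3 ^ n) (hexp : Monoid.exponent G ≠ 3)
    (hOmega : Subgroup.closure {x : G | x ^ 3 = 1} = ⊤) :
    (numCyclicSubgroups G : ℚ) ≤ (23 * 3 ^ (n - 3) + 1) / 2 := by
  have hfin : Finite G := Nat.finite_of_card_ne_zero (by rw [hG]; positivity)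
  obtain ⟨m, rfl⟩ := Nat.exists_eq_add_of_le' hn
  have hne : ∃ x : G, x ^ 3 ≠ 1 := by
    by_contra! h
    rcases (Nat.dvd_prime Nat.prime_three).1 (Monoid.exponent_dvd_of_forall_pow_eq_one h) with h | h
    · have := Monoid.exp_eq_one_iff.1 h
      have h1 : Nat.card G = 1 := Nat.card_unique
      rw [hG, Nat.pow_eq_one] at h1
      omega
    · exact hexp h
  have h1 := cube_card_le_of_card_eq G hG hne
  have h2 := six_mul_numCyclicSubgroups_le (IsPGroup.of_card hG)
  rw [hG, pow_add] at h1 h2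
  have h3 : 2 * numCyclicSubgroups G ≤ 23 * 3 ^ m + 1 := by omega
  have h4 : 2 * (numCyclicSubgroups G : ℚ) ≤ 23 * 3 ^ m + 1 := by exact_mod_cast h3
  rw [Nat.add_sub_cancel]
  linarith
end
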